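/- For every π₁, π₂ ∈ [0,1), every b ∈ [−1/2, 1/2], and every λ ∈ (0, π), Re[Π(λ)·e^{ibλ}] > 0; equivalently, (1+π₁π₂)·cos(bλ) − π₁·cos((b−1)λ) − π₂·cos((b+1)λ) > 0. -/

import Mathlib

noncomputable section

def Dfn (l : ℝ) : ℝ := (2 / Real.pi) * (Real.sin (l / 2)) ^ 2 / l ^ 2

def Pifn (p1 p2 : ℝ) (l : ℝ) : ℂ :=
  (((1 - p1) * (1 - p2) : ℝ) : ℂ) /
    ((1 - (p1 : ℂ) * Complex.exp (Complex.I * l)) *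
      (1 - (p2 : ℂ) * Complex.exp (-(Complex.I * l))))

def HLfn (L : ℕ) (l : ℝ) : ℝ :=
  2 * (Real.sin (l / 2)) ^ L *
    ∑ p ∈ Finset.range (L / 2), ((L / 2 - 1 + p).choose p : ℝ) * (Real.cos (l / 2)) ^ (2 * p)

def GLfn (L : ℕ) (l : ℝ) : ℝ := HLfn L (l - Real.pi)

def HjL (j L : ℕ) (l : ℝ) : ℝ :=
  HLfn L (2 ^ (j - 1) * l) * ∏ i ∈ Finset.range (j - 1), GLfn L (2 ^ i * l)

def cL (L : ℕ) : ℝ := ((L - 2).choose (L / 2 - 1) : ℝ) * ((L : ℝ) - 1) / 2 ^ (L - 2)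

def Lam (j : ℤ) : Set ℝ :=
  Set.Ico (-((2 : ℝ) ^ (j + 1) * Real.pi)) (-((2 : ℝ) ^ j * Real.pi)) ∪
    Set.Ioc ((2 : ℝ) ^ j * Real.pi) ((2 : ℝ) ^ (j + 1) * Real.pi)

def tauJ (J : ℕ) : ℝ := ((2 : ℝ) ^ (J + 1))⁻¹

def fJ (R θv : ℕ → ℝ) (J : ℕ) (l : ℝ) : ℂ :=
  ∑ i ∈ Finset.Icc 1 (J + 1),
    ((R i : ℝ) : ℂ) * Complex.exp (-(Complex.I * (θv i : ℝ) * l)) *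
      (Lam ((J : ℤ) - i + 1)).indicator (fun _ => (1 : ℂ)) l

def rhoBar (R θv : ℕ → ℝ) (p1 p2 : ℝ) (j L J : ℕ) (th : ℝ) : ℂ :=
  ∫ l : ℝ, ((Dfn l : ℝ) : ℂ) * ((HjL j L l : ℝ) : ℂ) * Pifn p1 p2 l *
    Complex.exp (Complex.I * ((tauJ J)⁻¹ * th) * l) * fJ R θv J ((tauJ J)⁻¹ * l)

def psiLP (s : ℝ) : ℝ :=
  if s = 0 then 1
  else 2 * (Real.sin (2 * Real.pi * s) / (2 * Real.pi * s)) - Real.sin (Real.pi * s) / (Real.pi * s)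

def psiLPj (j : ℤ) (t : ℝ) : ℝ := (2 : ℝ) ^ ((j : ℝ) / 2) * psiLP ((2 : ℝ) ^ j * t)


theorem cos_combination_pos {p1 p2 b l : ℝ} (hp1 : p1 ∈ Set.Ico (0 : ℝ) 1)
    (hp2 : p2 ∈ Set.Ico (0 : ℝ) 1) (hb : b ∈ Set.Icc (-(1 / 2) : ℝ) (1 / 2))
    (hl : l ∈ Set.Ioo (0 : ℝ) Real.pi) :
    0 < (1 + p1 * p2) * Real.cos (b * l) - p1 * Real.cos ((b - 1) * l) -
        p2 * Real.cos ((b + 1) * l) := by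
  obtain ⟨hp1, hp1'⟩ := hp1
  obtain ⟨hp2, hp2'⟩ := hp2
  obtain ⟨hb, hb'⟩ := hb
  obtain ⟨hl, hl'⟩ := hl
  have hcos : 0 < Real.cos (b * l) :=
    Real.cos_pos_of_mem_Ioo ⟨by nlinarith, by nlinarith⟩
  have hsin : 0 ≤ Real.sin (l / 2) :=
    Real.sin_nonneg_of_nonneg_of_le_pi (by linarith) (by linarith)
  have hminus : 0 ≤ Real.cos (b * l) - Real.cos ((b - 1) * l) := by
    have h : 0 ≤ Real.sin ((1 / 2 - b) * l) :=
      Real.sin_nonneg_of_nonneg_of_le_pi (by nlinarith) (by nlinarith)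
    rw [Real.cos_sub_cos, show (b * l + (b - 1) * l) / 2 = -((1 / 2 - b) * l) by ring,
      show (b * l - (b - 1) * l) / 2 = l / 2 by ring, Real.sin_neg]
    nlinarith [mul_nonneg h hsin]
  have hplus : 0 ≤ Real.cos (b * l) - Real.cos ((b + 1) * l) := by
    have h : 0 ≤ Real.sin ((b + 1 / 2) * l) :=
      Real.sin_nonneg_of_nonneg_of_le_pi (by nlinarith) (by nlinarith)
    rw [Real.cos_sub_cos, show (b * l + (b + 1) * l) / 2 = (b + 1 / 2) * l by ring,
      show (b * l - (b + 1) * l) / 2 = -(l / 2) by ring, Real.sin_neg]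
    nlinarith [mul_nonneg h hsin]
  -- The expression is affine in `p1` and in `p2`, so it interpolates its values at the corners.
  have h00 : 0 < (1 - p1) * (1 - p2) * Real.cos (b * l) :=
    mul_pos (mul_pos (by linarith) (by linarith)) hcos
  have h10 := mul_nonneg (mul_nonneg hp1 (sub_nonneg.2 hp2'.le)) hminus
  have h01 := mul_nonneg (mul_nonneg (sub_nonneg.2 hp1'.le) hp2) hplus
  have h11 := mul_nonneg (mul_nonneg hp1 hp2) (add_nonneg hminus hplus)
  linarith

theorem one_sub_mul_exp_ne_zero {p : ℝ} (hp : p ∈ Set.Ico (0 : ℝ) 1) (x : ℝ) :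
    1 - (p : ℂ) * Complex.exp (Complex.I * x) ≠ 0 := by
  intro h
  have h' := congrArg norm (sub_eq_zero.1 h)
  rw [norm_mul, mul_comm Complex.I, Complex.norm_exp_ofReal_mul_I, Complex.norm_real,
    Real.norm_of_nonneg hp.1, norm_one] at h'
  linarith [hp.2]

theorem re_Pifn_mul_exp (p1 p2 b l : ℝ) :
    (Pifn p1 p2 l * Complex.exp (Complex.I * b * l)).re =
      (1 - p1) * (1 - p2) *
        ((1 + p1 * p2) * Real.cos (b * l) - p1 * Real.cos ((b - 1) * l) -
          p2 * Real.cos ((b + 1) * l)) /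
        Complex.normSq ((1 - (p1 : ℂ) * Complex.exp (Complex.I * l)) *
          (1 - (p2 : ℂ) * Complex.exp (-(Complex.I * l)))) := by
  rw [Pifn, div_mul_eq_mul_div, Complex.div_re, ← add_div]
  congr 1
  rw [sub_one_mul, add_one_mul, Real.cos_sub, Real.cos_add,
    show Complex.I * (b : ℂ) * l = ((b * l : ℝ) : ℂ) * Complex.I by push_cast; ring,
    show -(Complex.I * (l : ℂ)) = ((-l : ℝ) : ℂ) * Complex.I by push_cast; ring,
    mul_comm Complex.I]
  simp only [Complex.mul_re, Complex.mul_im, Complex.sub_re, Complex.sub_im, Complex.one_re,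
    Complex.one_im, Complex.ofReal_re, Complex.ofReal_im, Complex.exp_ofReal_mul_I_re,
    Complex.exp_ofReal_mul_I_im, Real.cos_neg, Real.sin_neg]
  linear_combination (1 - p1) * (1 - p2) * p1 * p2 * Real.cos (b * l) * Real.sin_sq_add_cos_sq l

theorem statement12
    (p1 p2 : ℝ) (hp1 : p1 ∈ Set.Ico (0 : ℝ) 1) (hp2 : p2 ∈ Set.Ico (0 : ℝ) 1)
    (b : ℝ) (hb : b ∈ Set.Icc (-(1 / 2) : ℝ) (1 / 2))
    (l : ℝ) (hl : l ∈ Set.Ioo (0 : ℝ) Real.pi) :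
    0 < (Pifn p1 p2 l * Complex.exp (Complex.I * b * l)).re ∧
    0 < (1 + p1 * p2) * Real.cos (b * l) - p1 * Real.cos ((b - 1) * l) -
        p2 * Real.cos ((b + 1) * l) := by
  have h := cos_combination_pos hp1 hp2 hb hl
  refine ⟨?_, h⟩
  rw [re_Pifn_mul_exp]
  refine div_pos (mul_pos (mul_pos (sub_pos.2 hp1.2) (sub_pos.2 hp2.2)) h)
    (Complex.normSq_pos.2 (mul_ne_zero (one_sub_mul_exp_ne_zero hp1 l) ?_))
  simpa using one_sub_mul_exp_ne_zero hp2 (-l)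

end
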